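/- arXiv:2004.00684 — 3 statements merged into one kernel-verified Lean document; each statement's English description precedes it below -/
import Mathlib

section
/- For all integers n ≥ 0 and k ≥ 1, the number of lattice paths of length n that stay in the strip [-⌊(k+1)/2⌋, ⌊k/2⌋] and end at height 0 or at height -1 is equal to the number of lattice paths of length n that stay in the strip [0, k] (with no restriction on the final height). -/
/-- The height of a lattice path `s : Fin n → ℤ` after `j` steps:
the sum of the first `j` steps. -/
def pathHeight {n : ℕ} (s : Fin n → ℤ) (j : ℕ) : ℤ :=
  ∑ i ∈ Finset.univ.filter (fun i : Fin n => (i : ℕ) < j), s i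

/-- The number of lattice paths of length `n` (steps `±1`) whose height stays in
`[a, b]` at every time `0 ≤ j ≤ n` and whose final height lies in `E`. -/
noncomputable def pathCount (n : ℕ) (a b : ℤ) (E : Set ℤ) : ℕ :=
  Nat.card {s : Fin n → ℤ //
    (∀ i, s i ∈ ({1, -1} : Set ℤ)) ∧
    (∀ j ≤ n, pathHeight s j ∈ Set.Icc a b) ∧
    pathHeight s n ∈ E}

/-- The set of `±1` step sequences counted by `pathCount`. -/
def pathSet (n : ℕ) (a b : ℤ) (E : Set ℤ) : Set (Fin n → ℤ) :=
  {s | (∀ i, s i ∈ ({1, -1} : Set ℤ)) ∧ (∀ j ≤ n, pathHeight s j ∈ Set.Icc a b) ∧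
    pathHeight s n ∈ E}

lemma pathCount_eq_ncard (n : ℕ) (a b : ℤ) (E : Set ℤ) :
    pathCount n a b E = (pathSet n a b E).ncard :=
  Nat.card_coe_set_eq (pathSet n a b E)

lemma pathSet_finite (n : ℕ) (a b : ℤ) (E : Set ℤ) : (pathSet n a b E).Finite :=
  (Set.Finite.pi' (fun _ : Fin n => Set.toFinite ({1, -1} : Set ℤ))).subset fun _ hs => hs.1

@[simp] lemma pathHeight_zero {n : ℕ} (s : Fin n → ℤ) : pathHeight s 0 = 0 := by
  simp [pathHeight]

lemma pathHeight_cons {n : ℕ} (e : ℤ) (s : Fin n → ℤ) (j : ℕ) :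
    pathHeight (Fin.cons e s : Fin (n + 1) → ℤ) (j + 1) = e + pathHeight s j := by
  simp [pathHeight, Finset.sum_filter, Fin.sum_univ_succ]

lemma cons_mem_pathSet {n : ℕ} {a b : ℤ} {E : Set ℤ} (ha : a ≤ 0) (hb : 0 ≤ b) (e : ℤ)
    (s : Fin n → ℤ) :
    (Fin.cons e s : Fin (n + 1) → ℤ) ∈ pathSet (n + 1) a b E ↔
      e ∈ ({1, -1} : Set ℤ) ∧ s ∈ pathSet n (a - e) (b - e) {h | e + h ∈ E} := by
  have hheight : (∀ j ≤ n + 1, pathHeight (Fin.cons e s : Fin (n + 1) → ℤ) j ∈ Set.Icc a b) ↔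
      ∀ j ≤ n, pathHeight s j ∈ Set.Icc (a - e) (b - e) := by
    constructor
    · intro h j hj
      have := h (j + 1) (by omega)
      rw [pathHeight_cons, Set.mem_Icc] at this
      rw [Set.mem_Icc]
      omega
    · rintro h (_ | j) hj
      · simp [ha, hb]
      · have := h j (by omega)
        rw [Set.mem_Icc] at this
        rw [pathHeight_cons, Set.mem_Icc]
        omega
  simp only [pathSet, Set.mem_ofPred_eq, hheight, pathHeight_cons, Fin.forall_fin_succ,
    Fin.cons_zero, Fin.cons_succ, and_assoc]

lemma pathCount_succ (n : ℕ) {a b : ℤ} (ha : a ≤ 0) (hb : 0 ≤ b) (E : Set ℤ) :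
    pathCount (n + 1) a b E = pathCount n (a - 1) (b - 1) {h | 1 + h ∈ E} +
      pathCount n (a - -1) (b - -1) {h | -1 + h ∈ E} := by
  have hinj (e : ℤ) : Function.Injective (fun s : Fin n → ℤ => (Fin.cons e s : Fin (n + 1) → ℤ)) :=
    Fin.cons_right_injective (α := fun _ => ℤ) e
  have hunion : pathSet (n + 1) a b E =
      (fun s : Fin n → ℤ => (Fin.cons 1 s : Fin (n + 1) → ℤ)) ''
        pathSet n (a - 1) (b - 1) {h | 1 + h ∈ E} ∪
      (fun s : Fin n → ℤ => (Fin.cons (-1) s : Fin (n + 1) → ℤ)) ''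
        pathSet n (a - -1) (b - -1) {h | -1 + h ∈ E} := by
    ext t
    constructor
    · intro ht
      rw [← Fin.cons_self_tail t, cons_mem_pathSet ha hb] at ht
      obtain ⟨h | h, hs⟩ := ht
      · rw [h] at hs
        exact Or.inl ⟨_, hs, by simp [← h]⟩
      · rw [Set.mem_singleton_iff] at h
        rw [h] at hs
        exact Or.inr ⟨_, hs, by simp [← h]⟩
    · rintro (⟨s, hs, rfl⟩ | ⟨s, hs, rfl⟩)
      · exact (cons_mem_pathSet ha hb _ _).2 ⟨by simp, hs⟩
      · exact (cons_mem_pathSet ha hb _ _).2 ⟨by simp, hs⟩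
  simp only [pathCount_eq_ncard]
  rw [hunion, Set.ncard_union_eq _ ((pathSet_finite _ _ _ _).image _)
    ((pathSet_finite _ _ _ _).image _), Set.ncard_image_of_injective _ (hinj _),
    Set.ncard_image_of_injective _ (hinj _)]
  rw [Set.disjoint_left]
  rintro _ ⟨s, -, rfl⟩ ⟨t, -, h⟩
  have := congrFun h 0
  simp at this

lemma pathCount_eq_zero (n : ℕ) {a b : ℤ} (h : ¬ (a ≤ 0 ∧ 0 ≤ b)) (E : Set ℤ) :
    pathCount n a b E = 0 := by
  rw [pathCount_eq_ncard, Set.ncard_eq_zero (pathSet_finite _ _ _ _),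
    Set.eq_empty_iff_forall_notMem]
  intro s hs
  have := hs.2.1 0 (Nat.zero_le _)
  rw [pathHeight_zero] at this
  exact h this

lemma pathCount_zero {a b : ℤ} (ha : a ≤ 0) (hb : 0 ≤ b) (E : Set ℤ)
    [Decidable ((0 : ℤ) ∈ E)] :
    pathCount 0 a b E = if (0 : ℤ) ∈ E then 1 else 0 := by
  rw [pathCount_eq_ncard]
  split_ifs with h
  · rw [show pathSet 0 a b E = Set.univ from Set.eq_univ_of_forall fun s =>
      ⟨fun i => i.elim0, fun j hj => by simp [Nat.le_zero.1 hj, ha, hb], by simpa using h⟩]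
    simp
  · rw [show pathSet 0 a b E = ∅ from Set.eq_empty_of_forall_notMem fun s hs =>
      h (by simpa using hs.2.2)]
    simp

/-- The number of `±1` walks of length `n` from `x` to `y` inside `[0, k]`. -/
def stripWalks (k : ℕ) : ℕ → ℤ → ℤ → ℕ
  | 0, x, y => if 0 ≤ x ∧ x ≤ k ∧ x = y then 1 else 0
  | n + 1, x, y =>
    if 0 ≤ x ∧ x ≤ k then stripWalks k n (x + 1) y + stripWalks k n (x - 1) y else 0

lemma stripWalks_succ_right (k n : ℕ) (x y : ℤ) :
    stripWalks k (n + 1) x y =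
      if 0 ≤ y ∧ y ≤ k then stripWalks k n x (y + 1) + stripWalks k n x (y - 1) else 0 := by
  induction n generalizing x y with
  | zero =>
    simp only [stripWalks]
    split_ifs <;> omega
  | succ n ih =>
    rw [stripWalks, ih, ih]
    simp only [stripWalks]
    split_ifs <;> omega

lemma stripWalks_comm (k n : ℕ) (x y : ℤ) : stripWalks k n x y = stripWalks k n y x := by
  induction n generalizing x y with
  | zero =>
    simp only [stripWalks]
    split_ifs <;> omega
  | succ n ih => rw [stripWalks_succ_right, stripWalks, ih x (y + 1), ih x (y - 1)]

lemma stripWalks_of_left_notMem {k : ℕ} (n : ℕ) {x : ℤ} (hx : ¬ (0 ≤ x ∧ x ≤ k)) (y : ℤ) :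
    stripWalks k n x y = 0 := by
  cases n with
  | zero => rw [stripWalks, if_neg (by tauto)]
  | succ n => rw [stripWalks, if_neg hx]

/-- The walk counts satisfy the discrete wave equation in the two endpoints. -/
lemma stripWalks_wave {k : ℕ} (n : ℕ) {x y : ℤ} (hx : 0 ≤ x ∧ x ≤ k) (hy : 0 ≤ y ∧ y ≤ k) :
    stripWalks k n (x + 1) y + stripWalks k n (x - 1) y =
      stripWalks k n x (y + 1) + stripWalks k n x (y - 1) := by
  have h := stripWalks_succ_right k n x y
  rwa [stripWalks, if_pos hx, if_pos hy] at h

/-- Solution of the discrete wave equation in terms of the values on the line `x = 0`. -/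
lemma stripWalks_eq_sum (k n x d : ℕ) (h : 2 * x + d ≤ k + 1) :
    stripWalks k n x ((x : ℤ) + d) =
      ∑ i ∈ Finset.range (x + 1), stripWalks k n 0 ((d : ℤ) + 2 * i) := by
  induction x using Nat.strong_induction_on generalizing d with
  | _ x ih =>
    match x with
    | 0 => simp
    | 1 =>
      have hw := stripWalks_wave (k := k) n (x := 0) (y := 1 + d) (by omega) (by omega)
      rw [stripWalks_of_left_notMem n (x := 0 - 1) (by omega)] at hw
      have e1 : (1 : ℤ) + d + 1 = d + 2 := by ring
      have e2 : (1 : ℤ) + d - 1 = d := by ring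
      rw [e1, e2] at hw
      simp [Finset.sum_range_succ]
      simp at hw
      omega
    | x + 2 =>
      have hw := stripWalks_wave (k := k) n (x := x + 1) (y := x + 2 + d) (by omega) (by omega)
      have h1 := ih (x + 1) (by omega) (d + 2) (by omega)
      have h2 : stripWalks k n (x + 1 : ℕ) ((x + 1 : ℕ) + d) =
          ∑ i ∈ Finset.range (x + 2), stripWalks k n 0 ((d : ℤ) + 2 * i) :=
        ih (x + 1) (by omega) d (by omega)
      have h3 := ih x (by omega) (d + 2) (by omega)
      have e1 : (x : ℤ) + 2 + d + 1 = ((x + 1 : ℕ) : ℤ) + (d + 2 : ℕ) := by push_cast; ring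
      have e2 : (x : ℤ) + 2 + d - 1 = ((x + 1 : ℕ) : ℤ) + d := by push_cast; ring
      have e3 : (x : ℤ) + 2 + d = (x : ℤ) + (d + 2 : ℕ) := by push_cast; ring
      have e4 : (x : ℤ) + 1 = ((x + 1 : ℕ) : ℤ) := by push_cast; ring
      have e5 : (x : ℤ) + 1 - 1 = x := by ring
      have e6 : (x : ℤ) + 1 + 1 = ((x + 2 : ℕ) : ℤ) := by push_cast; ring
      have e7 : ((x + 2 : ℕ) : ℤ) + d = (x : ℤ) + (d + 2 : ℕ) := by push_cast; ring
      rw [e1, e2, e3, e5, e6, e4, h1, h2, h3] at hw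
      have h4 := Finset.sum_range_succ
        (fun i : ℕ => stripWalks k n 0 (((d + 2 : ℕ) : ℤ) + 2 * i)) (x + 1)
      have e8 : ((d + 2 : ℕ) : ℤ) + 2 * (x + 1 : ℕ) = (d : ℤ) + 2 * (x + 2 : ℕ) := by
        push_cast; ring
      rw [e8] at h4
      rw [Finset.sum_range_succ, e7]
      omega

lemma pathCount_eq_sum_stripWalks (k n : ℕ) (x : ℤ) (E : Set ℤ) [DecidablePred (· ∈ E)] :
    pathCount n (-x) (k - x) {h | x + h ∈ E} =
      ∑ y ∈ Finset.range (k + 1), if (y : ℤ) ∈ E then stripWalks k n x y else 0 := by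
  by_cases hx : 0 ≤ x ∧ x ≤ k
  swap
  · rw [pathCount_eq_zero n (by omega)]
    simp [stripWalks_of_left_notMem n hx]
  induction n generalizing x with
  | zero =>
    classical
    rw [pathCount_zero (by omega) (by omega)]
    obtain ⟨m, rfl⟩ := Int.eq_ofNat_of_zero_le hx.1
    rw [Finset.sum_eq_single m]
    · have hm : m ≤ k := by omega
      simp [stripWalks, hm]
    · intro y _ hy
      have : (m : ℤ) ≠ y := by omega
      simp [stripWalks, this]
    · intro hm
      rw [Finset.mem_range] at hm
      omega
  | succ n ih =>
    have ih' (x : ℤ) : pathCount n (-x) (k - x) {h | x + h ∈ E} =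
        ∑ y ∈ Finset.range (k + 1), if (y : ℤ) ∈ E then stripWalks k n x y else 0 := by
      by_cases hx : 0 ≤ x ∧ x ≤ k
      · exact ih x hx
      · rw [pathCount_eq_zero n (by omega)]
        simp [stripWalks_of_left_notMem n hx]
    have h1 := ih' (x + 1)
    have h2 := ih' (x - 1)
    rw [pathCount_succ n (by omega) (by omega)]
    simp only [stripWalks, if_pos hx]
    have e1 : -x - 1 = -(x + 1) := by ring
    have e2 : (k : ℤ) - x - 1 = k - (x + 1) := by ring
    have e3 : -x - -1 = -(x - 1) := by ring
    have e4 : (k : ℤ) - x - -1 = k - (x - 1) := by ring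
    have e5 (h : ℤ) : x + (1 + h) = x + 1 + h := by ring
    have e6 (h : ℤ) : x + (-1 + h) = x - 1 + h := by ring
    simp only [Set.mem_ofPred_eq, e1, e2, e3, e4, e5, e6, h1, h2]
    rw [← Finset.sum_add_distrib]
    refine Finset.sum_congr rfl fun y _ => ?_
    split_ifs <;> rfl

lemma sum_range_even_add_odd (f : ℕ → ℕ) (c : ℕ) :
    ∑ i ∈ Finset.range (c + 1), f (2 * i) + ∑ i ∈ Finset.range c, f (1 + 2 * i) =
      ∑ j ∈ Finset.range (2 * c + 1), f j := by
  induction c with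
  | zero => simp
  | succ c ih =>
    rw [Finset.sum_range_succ (fun i => f (2 * i)) (c + 1),
      Finset.sum_range_succ (fun i => f (1 + 2 * i)) c,
      show 2 * (c + 1) + 1 = 2 * c + 1 + 1 + 1 by ring, Finset.sum_range_succ f (2 * c + 1 + 1),
      Finset.sum_range_succ f (2 * c + 1), ← ih, show 2 * (c + 1) = 2 * c + 1 + 1 by ring,
      show 1 + 2 * c = 2 * c + 1 by ring]
    ring

theorem stmt_0 (n k : ℕ) (hk : 1 ≤ k) :
    pathCount n (-(((k + 1) / 2 : ℕ) : ℤ)) ((k / 2 : ℕ) : ℤ) ({0, -1} : Set ℤ)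
      = pathCount n 0 (k : ℤ) Set.univ := by
  classical
  obtain ⟨c, hc⟩ : ∃ c, (k + 1) / 2 = c + 1 := ⟨(k + 1) / 2 - 1, by omega⟩
  have hl := pathCount_eq_sum_stripWalks k n ((c + 1 : ℕ) : ℤ) {((c + 1 : ℕ) : ℤ), (c : ℤ)}
  have hr := pathCount_eq_sum_stripWalks k n 0 Set.univ
  have hE : {h : ℤ | ((c + 1 : ℕ) : ℤ) + h ∈ ({((c + 1 : ℕ) : ℤ), (c : ℤ)} : Set ℤ)} = {0, -1} := by
    ext h
    simp only [Set.mem_ofPred_eq, Set.mem_insert_iff, Set.mem_singleton_iff]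
    omega
  rw [hE, show (k : ℤ) - (c + 1 : ℕ) = (k / 2 : ℕ) by omega] at hl
  simp only [neg_zero, sub_zero, Set.mem_univ, Set.ofPred_true, if_true] at hr
  have hdiag := stripWalks_eq_sum k n (c + 1) 0 (by omega)
  have hoff := stripWalks_eq_sum k n c 1 (by omega)
  have hsum := sum_range_even_add_odd (fun j => stripWalks k n 0 j) (c + 1)
  have hends : ∑ y ∈ Finset.range (k + 1),
      (if (y : ℤ) ∈ ({((c + 1 : ℕ) : ℤ), (c : ℤ)} : Set ℤ) then
        stripWalks k n (c + 1 : ℕ) y else 0) =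
      stripWalks k n (c + 1 : ℕ) (c + 1 : ℕ) + stripWalks k n (c + 1 : ℕ) c := by
    rw [← Finset.sum_filter, show (Finset.range (k + 1)).filter
      (fun y : ℕ => (y : ℤ) ∈ ({((c + 1 : ℕ) : ℤ), (c : ℤ)} : Set ℤ)) = {c + 1, c} by
        ext y
        simp only [Finset.mem_filter, Finset.mem_range, Set.mem_insert_iff,
          Set.mem_singleton_iff, Finset.mem_insert, Finset.mem_singleton]
        omega]
    rw [Finset.sum_pair (by omega)]
  have hfull : ∑ j ∈ Finset.range (2 * (c + 1) + 1), stripWalks k n 0 j =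
      ∑ j ∈ Finset.range (k + 1), stripWalks k n 0 j := by
    obtain h | h : 2 * (c + 1) = k ∨ 2 * (c + 1) = k + 1 := by omega
    · rw [h]
    · rw [h, Finset.sum_range_succ, stripWalks_comm, stripWalks_of_left_notMem n (by omega),
        add_zero]
  rw [hc, hl, hr, hends, ← hfull, ← hsum, stripWalks_comm k n (c + 1 : ℕ) c]
  push_cast at hdiag hoff ⊢
  simp only [add_zero, zero_add] at hdiag
  rw [hdiag, hoff]
end

section
/- Define the sequence of polynomials D : ℕ → Polynomial ℤ by D(0) = 1, D(1) = 1, and D(j+2) = D(j+1) - X^2 · D(j). Then for every natural number k, D(k)^2 = Σ_{j=0}^{k} X^(2j) · D(2k - 2j). -/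
open Polynomial in
/-- The determinant polynomials: `D 0 = 1`, `D 1 = 1`, `D (j+2) = D (j+1) - X^2 * D j`. -/
noncomputable def Dseq : ℕ → Polynomial ℤ
  | 0 => 1
  | 1 => 1
  | (j + 2) => Dseq (j + 1) - X ^ 2 * Dseq j

open Polynomial in
theorem Dseq_add_two (j : ℕ) : Dseq (j + 2) = Dseq (j + 1) - X ^ 2 * Dseq j := by
  rw [Dseq]

open Polynomial in
theorem Dseq_add_add_two (m n : ℕ) :
    Dseq (m + n + 2) = Dseq (m + 1) * Dseq (n + 1) - X ^ 2 * (Dseq m * Dseq n) := by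
  induction m generalizing n with
  | zero => simp [Dseq]
  | succ m ih =>
    have h := ih (n + 1)
    rw [show m + 1 + n + 2 = m + (n + 1) + 2 by ring, h, Dseq_add_two n, Dseq_add_two m]
    ring

open Polynomial in
theorem stmt_7 (k : ℕ) :
    Dseq k ^ 2 = ∑ j ∈ Finset.range (k + 1), X ^ (2 * j) * Dseq (2 * k - 2 * j) := by
  induction k with
  | zero => simp [Dseq]
  | succ k ih =>
    have h := Dseq_add_add_two k k
    have hs : ∑ j ∈ Finset.range (k + 1), X ^ (2 * (j + 1)) * Dseq (2 * (k + 1) - 2 * (j + 1)) =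
        X ^ 2 * Dseq k ^ 2 := by
      rw [ih, Finset.mul_sum]
      refine Finset.sum_congr rfl fun j _ => ?_
      rw [show 2 * (k + 1) - 2 * (j + 1) = 2 * k - 2 * j by omega]
      ring
    rw [Finset.sum_range_succ', hs, show 2 * (k + 1) - 2 * 0 = k + k + 2 by omega, h]
    ring
end

section
/- For every integer n ≥ 1, the number of lattice paths of length 2n that stay in the strip [0, 3] and end at height 0 equals the Fibonacci number F(2n-1). -/
/-- The `±1` paths of length `n` staying in `[a, b]` and ending at height `m`. -/
def stripPaths (n : ℕ) (a b m : ℤ) : Set (Fin n → ℤ) :=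
  {s | (∀ i, s i ∈ ({1, -1} : Set ℤ)) ∧ (∀ j ≤ n, pathHeight s j ∈ Set.Icc a b) ∧
    pathHeight s n ∈ ({m} : Set ℤ)}

theorem pathCount_singleton (n : ℕ) (a b m : ℤ) :
    pathCount n a b {m} = (stripPaths n a b m).ncard := rfl

theorem pathHeight_snoc_of_le {n : ℕ} (s : Fin n → ℤ) (x : ℤ) {j : ℕ} (hj : j ≤ n) :
    pathHeight (Fin.snoc s x : Fin (n + 1) → ℤ) j = pathHeight s j := by
  simp [pathHeight, Finset.sum_filter, Fin.sum_univ_castSucc, hj]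

theorem pathHeight_snoc_succ {n : ℕ} (s : Fin n → ℤ) (x : ℤ) :
    pathHeight (Fin.snoc s x : Fin (n + 1) → ℤ) (n + 1) = pathHeight s n + x := by
  simp only [pathHeight, Finset.sum_filter, Fin.sum_univ_castSucc, Fin.snoc_castSucc,
    Fin.snoc_last, Fin.is_lt, if_true]

theorem snoc_mem_stripPaths_iff {n : ℕ} {a b m : ℤ} (hm : m ∈ Set.Icc a b)
    (s : Fin n → ℤ) (x : ℤ) :
    (Fin.snoc s x : Fin (n + 1) → ℤ) ∈ stripPaths (n + 1) a b m ↔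
      (x = 1 ∨ x = -1) ∧ s ∈ stripPaths n a b (m - x) := by
  simp only [stripPaths, Set.mem_ofPred_eq, Fin.forall_fin_succ', Fin.snoc_castSucc,
    Fin.snoc_last, pathHeight_snoc_succ, Set.mem_singleton_iff, Set.mem_insert_iff]
  constructor
  · rintro ⟨⟨h1, h2⟩, h3, h4⟩
    exact ⟨h2, h1, fun j hj => pathHeight_snoc_of_le s x hj ▸ h3 j (by omega), by omega⟩
  · rintro ⟨h2, h1, h3, h4⟩
    refine ⟨⟨h1, h2⟩, fun j hj => ?_, by omega⟩
    rcases Nat.le_succ_iff.mp hj with hj | rfl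
    · exact (pathHeight_snoc_of_le s x hj).symm ▸ h3 j hj
    · rwa [Nat.succ_eq_add_one, pathHeight_snoc_succ, h4, sub_add_cancel]

theorem snoc_left_injective {n : ℕ} (x : ℤ) :
    Function.Injective fun s : Fin n → ℤ => (Fin.snoc s x : Fin (n + 1) → ℤ) :=
  fun _ _ h => (Fin.snoc_injective2 h).1

theorem stripPaths_succ {n : ℕ} {a b m : ℤ} (hm : m ∈ Set.Icc a b) :
    stripPaths (n + 1) a b m =
      (fun s => (Fin.snoc s 1 : Fin (n + 1) → ℤ)) '' stripPaths n a b (m - 1) ∪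
      (fun s => (Fin.snoc s (-1) : Fin (n + 1) → ℤ)) '' stripPaths n a b (m + 1) := by
  ext t
  constructor
  · intro ht
    rw [← Fin.snoc_init_self t, snoc_mem_stripPaths_iff hm] at ht
    obtain ⟨h | h, hs⟩ := ht
    · rw [h] at hs
      exact Or.inl ⟨Fin.init t, hs, by rw [← h]; exact Fin.snoc_init_self t⟩
    · rw [h, sub_neg_eq_add] at hs
      exact Or.inr ⟨Fin.init t, hs, by rw [← h]; exact Fin.snoc_init_self t⟩
  · rintro (⟨s, hs, rfl⟩ | ⟨s, hs, rfl⟩)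
    · exact (snoc_mem_stripPaths_iff hm s 1).mpr ⟨Or.inl rfl, hs⟩
    · exact (snoc_mem_stripPaths_iff hm s (-1)).mpr ⟨Or.inr rfl, by rwa [sub_neg_eq_add]⟩

theorem encard_stripPaths_succ {n : ℕ} {a b m : ℤ} (hm : m ∈ Set.Icc a b) :
    (stripPaths (n + 1) a b m).encard =
      (stripPaths n a b (m - 1)).encard + (stripPaths n a b (m + 1)).encard := by
  rw [stripPaths_succ hm, Set.encard_union_eq, (snoc_left_injective 1).encard_image,
    (snoc_left_injective (-1)).encard_image]
  rw [Set.disjoint_left]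
  rintro _ ⟨s, -, rfl⟩ ⟨t, -, h⟩
  have := (Fin.snoc_injective2 h).2
  omega

theorem encard_stripPaths_of_notMem {n : ℕ} {a b m : ℤ} (hm : m ∉ Set.Icc a b) :
    (stripPaths n a b m).encard = 0 := by
  rw [Set.encard_eq_zero, Set.eq_empty_iff_forall_notMem]
  rintro s ⟨-, h, h'⟩
  exact hm (Set.mem_singleton_iff.mp h' ▸ h n le_rfl)

theorem encard_stripPaths_zero_self {a b : ℤ} (h : (0 : ℤ) ∈ Set.Icc a b) :
    (stripPaths 0 a b 0).encard = 1 := by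
  rw [Set.encard_eq_one]
  refine ⟨Fin.elim0, Set.eq_singleton_iff_unique_mem.mpr ⟨?_, fun _ _ => Subsingleton.elim _ _⟩⟩
  exact ⟨fun i => i.elim0, fun j _ => by simpa [pathHeight] using h, by simp [pathHeight]⟩

theorem encard_stripPaths_zero_of_ne {a b m : ℤ} (h : m ≠ 0) :
    (stripPaths 0 a b m).encard = 0 := by
  rw [Set.encard_eq_zero, Set.eq_empty_iff_forall_notMem]
  rintro s ⟨-, -, h'⟩
  exact h (by simpa [pathHeight] using h'.symm)

theorem encard_stripPaths_succ_zero (n : ℕ) :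
    (stripPaths (n + 1) 0 3 0).encard = (stripPaths n 0 3 1).encard := by
  rw [encard_stripPaths_succ (by simp), encard_stripPaths_of_notMem (m := 0 - 1) (by simp),
    zero_add, zero_add]

theorem encard_stripPaths_odd (k : ℕ) :
    (stripPaths (2 * k + 1) 0 3 1).encard = (Nat.fib (2 * k + 1) : ℕ∞) ∧
      (stripPaths (2 * k + 1) 0 3 3).encard = (Nat.fib (2 * k) : ℕ∞) := by
  have one (n : ℕ) : (stripPaths (n + 1) 0 3 1).encard =
      (stripPaths n 0 3 0).encard + (stripPaths n 0 3 2).encard :=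
    encard_stripPaths_succ (by simp)
  have two (n : ℕ) : (stripPaths (n + 1) 0 3 2).encard =
      (stripPaths n 0 3 1).encard + (stripPaths n 0 3 3).encard :=
    encard_stripPaths_succ (by simp)
  have three (n : ℕ) : (stripPaths (n + 1) 0 3 3).encard = (stripPaths n 0 3 2).encard := by
    rw [encard_stripPaths_succ (by simp), encard_stripPaths_of_notMem (m := 3 + 1) (by simp),
      add_zero]
    rfl
  induction k with
  | zero =>
    rw [one, three, encard_stripPaths_zero_self (by simp),
      encard_stripPaths_zero_of_ne (by simp)]
    simp
  | succ k ih =>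
    have h2 : Nat.fib (2 * (k + 1)) = Nat.fib (2 * k) + Nat.fib (2 * k + 1) := Nat.fib_add_two
    have h3 : Nat.fib (2 * (k + 1) + 1) = Nat.fib (2 * k + 1) + Nat.fib (2 * (k + 1)) :=
      Nat.fib_add_two
    rw [one, three, show 2 * (k + 1) = 2 * k + 1 + 1 by ring, encard_stripPaths_succ_zero, two,
      ih.1, ih.2, show 2 * k + 1 + 1 = 2 * (k + 1) by ring, h3, h2]
    push_cast
    exact ⟨by ring, by ring⟩

theorem stmt_10 (n : ℕ) (hn : 1 ≤ n) :
    pathCount (2 * n) 0 3 ({0} : Set ℤ) = Nat.fib (2 * n - 1) := by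
  obtain ⟨k, rfl⟩ := Nat.exists_eq_add_of_le' hn
  rw [pathCount_singleton, Set.ncard, show 2 * (k + 1) = 2 * k + 1 + 1 by ring,
    encard_stripPaths_succ_zero, (encard_stripPaths_odd k).1, ENat.toNat_natCast, Nat.add_sub_cancel]
end
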